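/- Let G be a cubic graph with a proper 3-edge-colouring, and let a, b be two distinct colours. The edges coloured a or b form a 2-factor of G; if two disjoint edges e and e' of G belong to the same cycle of this 2-factor, then the graph G' obtained from G by applying the edge-insertion operation to e and e' is colourable. -/

import Mathlib

open scoped Classical

namespace SnarkPaper

variable {V : Type*}

/-- A graph is cubic if every vertex has exactly 3 neighbours. -/
def IsCubic (G : SimpleGraph V) : Prop := ∀ v : V, (G.neighborSet v).ncard = 3

/-- A proper 3-edge-colouring: edges sharing an endpoint get different colours. -/
def Colourable3 (G : SimpleGraph V) : Prop :=
  ∃ c : Sym2 V → Fin 3, ∀ e₁ ∈ G.edgeSet, ∀ e₂ ∈ G.edgeSet,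
    e₁ ≠ e₂ → (∃ v, v ∈ e₁ ∧ v ∈ e₂) → c e₁ ≠ c e₂

/-- A subgraph is 2-regular if every one of its vertices has exactly two neighbours in it. -/
def IsTwoRegular {G : SimpleGraph V} (H : G.Subgraph) : Prop :=
  ∀ v ∈ H.verts, (H.neighborSet v).ncard = 2

/-- A cycle is a connected 2-regular subgraph. -/
def IsCycleSub {G : SimpleGraph V} (C : G.Subgraph) : Prop :=
  C.Connected ∧ IsTwoRegular C

/-- A 2-factor is a spanning 2-regular subgraph. -/
def IsTwoFactor {G : SimpleGraph V} (F : G.Subgraph) : Prop :=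
  F.IsSpanning ∧ IsTwoRegular F

/-- A 2-factor is even if all its cycles (connected components) have even length. -/
def IsEvenTwoFactor {G : SimpleGraph V} (F : G.Subgraph) : Prop :=
  IsTwoFactor F ∧ ∀ C : G.Subgraph, C ≤ F → IsCycleSub C → Even C.verts.ncard

/-- An even subgraph: every vertex has even degree. -/
def IsEvenSubgraph {G : SimpleGraph V} (H : G.Subgraph) : Prop :=
  ∀ v : V, Even (H.neighborSet v).ncard

/-- A cycle double cover: a multiset of cycles covering each edge exactly twice. -/
def IsCDC (G : SimpleGraph V) (D : Multiset G.Subgraph) : Prop :=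
  (∀ C ∈ D, IsCycleSub C) ∧
  ∀ e ∈ G.edgeSet, D.countP (fun C => e ∈ C.edgeSet) = 2

/-- A k-CDC, seen as a multiset of k even subgraphs covering each edge exactly twice. -/
def IsKCDC (G : SimpleGraph V) (k : ℕ) (D : Multiset G.Subgraph) : Prop :=
  D.card = k ∧ (∀ H ∈ D, IsEvenSubgraph H) ∧
  ∀ e ∈ G.edgeSet, D.countP (fun H => e ∈ H.edgeSet) = 2

/-- An edge set is even if every vertex meets an even number of its edges. -/
def EvenEdgeSet (S : Set (Sym2 V)) : Prop :=
  ∀ v : V, Even {w : V | s(v, w) ∈ S}.ncard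

/-- A k-CDC presented as a multiset of k even edge sets covering each edge exactly twice. -/
def IsKCDCEdgeSets (G : SimpleGraph V) (k : ℕ) (D : Multiset (Set (Sym2 V))) : Prop :=
  D.card = k ∧ (∀ S ∈ D, S ⊆ G.edgeSet ∧ EvenEdgeSet S) ∧
  ∀ e ∈ G.edgeSet, D.countP (fun S => e ∈ S) = 2

/-- The set A contains (the vertices of) a cycle of G. -/
def HasCycleIn (G : SimpleGraph V) (A : Set V) : Prop :=
  ∃ C : G.Subgraph, IsCycleSub C ∧ C.verts ⊆ A

/-- The edges of G crossing between A and its complement. -/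
def cutEdges (G : SimpleGraph V) (A : Set V) : Set (Sym2 V) :=
  {e ∈ G.edgeSet | ∃ x ∈ A, ∃ y ∉ A, e = s(x, y)}

/-- Cyclically k-edge-connected: every edge cut separating two cycles has at least k edges. -/
def CyclEdgeConn (G : SimpleGraph V) (k : ℕ) : Prop :=
  ∀ A : Set V, HasCycleIn G A → HasCycleIn G Aᶜ → k ≤ (cutEdges G A).ncard

/-- A snark: an uncolourable cyclically 4-edge-connected cubic graph with girth at least 5. -/
def IsSnark (G : SimpleGraph V) : Prop :=
  IsCubic G ∧ ¬ Colourable3 G ∧ CyclEdgeConn G 4 ∧ 5 ≤ G.girth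

/-- The edge-insertion operation applied to the edges ab and cd of G: subdivide each with a
new vertex (u = inr 0, v = inr 1) and join the two new vertices by an edge. -/
def edgeInsertion (G : SimpleGraph V) (a b c d : V) : SimpleGraph (V ⊕ Fin 2) :=
  SimpleGraph.fromEdgeSet
    ((Sym2.map Sum.inl '' (G.edgeSet \ {s(a, b), s(c, d)})) ∪
      {s(Sum.inl a, Sum.inr 0), s(Sum.inr 0, Sum.inl b),
       s(Sum.inl c, Sum.inr 1), s(Sum.inr 1, Sum.inl d),
       s(Sum.inr 0, Sum.inr 1)})

/-- A permutation graph: a cubic graph with a 2-factor consisting of two induced cycles. -/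
def IsPermutationGraph (G : SimpleGraph V) : Prop :=
  IsCubic G ∧ ∃ C₁ C₂ : G.Subgraph, IsCycleSub C₁ ∧ IsCycleSub C₂ ∧
    C₁.IsInduced ∧ C₂.IsInduced ∧ Disjoint C₁.verts C₂.verts ∧ IsTwoFactor (C₁ ⊔ C₂)

/-- The total weight of the edge cut determined by A. -/
noncomputable def cutWeight (G : SimpleGraph V) (w : Sym2 V → ℕ) (A : Set V) : ℕ :=
  ∑ᶠ e ∈ cutEdges G A, w e

/-- An eulerian (1,2)-weight: each edge gets weight 1 or 2 and every edge cut has even weight. -/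
def IsEulerianWeight (G : SimpleGraph V) (w : Sym2 V → ℕ) : Prop :=
  (∀ e ∈ G.edgeSet, w e = 1 ∨ w e = 2) ∧ ∀ A : Set V, Even (cutWeight G w A)

/-- A compatible cycle cover of (G, w): each edge e lies in exactly w(e) of the cycles. -/
def IsCompatibleCycleCover (G : SimpleGraph V) (w : Sym2 V → ℕ)
    (D : Multiset G.Subgraph) : Prop :=
  (∀ C ∈ D, IsCycleSub C) ∧
  ∀ e ∈ G.edgeSet, D.countP (fun C => e ∈ C.edgeSet) = w e


/-- Parity: a 2-regular graph has no vertex set left by exactly one edge. -/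
theorem no_single_cut {W : Type*} [Fintype W] (K : SimpleGraph W)
    (hdeg : ∀ v, (K.neighborSet v).ncard = 2) (S : Set W) (a b : W) (hab : K.Adj a b)
    (ha : a ∈ S) (hb : b ∉ S)
    (h : ∀ x y, K.Adj x y → s(x, y) ≠ s(a, b) → (x ∈ S ↔ y ∈ S)) : False := by
  let H : SimpleGraph W := 
    { Adj := fun x y => K.Adj x y ∧ x ∈ S ∧ y ∈ S
      symm := ⟨fun x y hxy => ⟨hxy.1.symm, hxy.2.2, hxy.2.1⟩⟩
      loopless := ⟨fun x hx => K.loopless.irrefl x hx.1⟩ }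
  have hd : ∀ v, H.degree v = (H.neighborSet v).ncard := fun v => by
    rw [← SimpleGraph.card_neighborSet_eq_degree, ← Nat.card_eq_fintype_card]; rfl
  have h1 : ∀ v, Odd (H.degree v) ↔ v = a := by
    intro v
    rw [hd]
    by_cases hv : v ∈ S
    · by_cases hva : v = a
      · subst hva
        have : H.neighborSet v = K.neighborSet v \ {b} := by
          ext w
          simp only [SimpleGraph.mem_neighborSet, H, Set.mem_sdiff, Set.mem_singleton_iff]
          constructor
          · rintro ⟨h1, h2, h3⟩
            exact ⟨h1, by rintro rfl; exact hb h3⟩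
          · rintro ⟨h1, h2⟩
            refine ⟨h1, hv, (h v w h1 ?_).1 hv⟩
            simpa [hab.ne] using h2
        rw [this, Set.ncard_sdiff_singleton_of_mem (by simpa using hab), hdeg]
        simp
      · have : H.neighborSet v = K.neighborSet v := by
          ext w
          simp only [SimpleGraph.mem_neighborSet, H]
          constructor
          · exact fun h => h.1
          · intro h1
            refine ⟨h1, hv, (h v w h1 ?_).1 hv⟩
            intro h2
            rw [Sym2.eq_iff] at h2
            rcases h2 with ⟨h2, _⟩ | ⟨h2, _⟩
            · exact hva h2
            · exact hb (h2 ▸ hv)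
        rw [this, hdeg]
        simp [hva]
    · have : H.neighborSet v = ∅ := by
        ext w
        simp [H, hv]
      rw [this]
      have : v ≠ a := by rintro rfl; exact hv ha
      simp [this]
  have h2 := H.even_card_odd_degree_vertices
  have h3 : (Finset.univ.filter fun v => Odd (H.degree v)) = {a} := by
    ext v; simp [h1]
  rw [h3] at h2
  simp at h2

/-- Removing two disjoint edges of a cycle splits it into two sides. -/
theorem exists_cut {W : Type*} [Fintype W] (K : SimpleGraph W) (hK : K.Connected)
    (hdeg : ∀ v, (K.neighborSet v).ncard = 2) (a b c d : W) (hab : K.Adj a b) (hcd : K.Adj c d)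
    (hne : s(a, b) ≠ s(c, d)) :
    ∃ S : Set W, (∀ x y, K.Adj x y → s(x, y) ≠ s(a, b) → s(x, y) ≠ s(c, d) →
      (x ∈ S ↔ y ∈ S)) ∧ (a ∈ S ↔ b ∉ S) ∧ (c ∈ S ↔ d ∉ S) := by
  let T : Finset (Sym2 W) := {s(a, b), s(c, d)}
  let K' := K.deleteEdges T
  have hT : T.card = 2 := Finset.card_pair hne
  have hcardE : K.edgeFinset.card = Fintype.card W := by
    have h1 := K.sum_degrees_eq_twice_card_edges
    have h2 : ∀ v, K.degree v = 2 := fun v => by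
      rw [← hdeg v, ← SimpleGraph.card_neighborSet_eq_degree, ← Nat.card_eq_fintype_card]; rfl
    simp [h2] at h1
    omega
  have hK' : ¬ K'.Connected := by
    intro h
    have h1 := h.card_vert_le_card_edgeSet_add_one
    have h2 : K'.edgeFinset = K.edgeFinset \ T := SimpleGraph.edgeFinset_deleteEdges _
    have h3 : T ⊆ K.edgeFinset := by
      intro e he
      simp only [T, Finset.mem_insert, Finset.mem_singleton] at he
      rcases he with rfl | rfl <;> simpa
    have h4 := Finset.card_sdiff_of_subset h3
    rw [← h2] at h4
    have h5 := Finset.card_le_card h3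
    rw [Nat.card_eq_fintype_card, Nat.card_eq_fintype_card, ← SimpleGraph.edgeFinset_card] at h1
    omega
  have : ∃ x y, ¬ K'.Reachable x y := by
    by_contra hcon
    push Not at hcon
    haveI := hK.nonempty
    exact hK' (SimpleGraph.Connected.mk hcon)
  obtain ⟨x0, y0, hxy⟩ := this
  let S : Set W := {z | K'.Reachable x0 z}
  have hS : ∀ x y, K.Adj x y → s(x, y) ≠ s(a, b) → s(x, y) ≠ s(c, d) → (x ∈ S ↔ y ∈ S) := by
    intro x y h1 h2 h3
    have h4 : K'.Adj x y := by
      simp only [K', SimpleGraph.deleteEdges_adj]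
      refine ⟨h1, ?_⟩
      simp only [T, Finset.coe_insert, Finset.coe_singleton, Set.mem_insert_iff,
        Set.mem_singleton_iff]
      tauto
    exact ⟨fun h => h.trans h4.reachable, fun h => h.trans h4.symm.reachable⟩
  have hx0 : x0 ∈ S := SimpleGraph.Reachable.refl _
  have hy0 : y0 ∉ S := hxy
  -- a cut by one edge is impossible
  have key : ∀ p q r t : W, K.Adj p q → (∀ x y, K.Adj x y → s(x, y) ≠ s(p, q) →
      s(x, y) ≠ s(r, t) → (x ∈ S ↔ y ∈ S)) → (r ∈ S ↔ t ∈ S) → (p ∈ S ↔ q ∈ S) := by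
    intro p q r t hpq h hrt
    have h' : ∀ x y, K.Adj x y → s(x, y) ≠ s(p, q) → (x ∈ S ↔ y ∈ S) := by
      intro x y h1 h2
      by_cases h3 : s(x, y) = s(r, t)
      · rw [Sym2.eq_iff] at h3
        rcases h3 with ⟨rfl, rfl⟩ | ⟨rfl, rfl⟩
        · exact hrt
        · exact hrt.symm
      · exact h x y h1 h2 h3
    by_contra hcon
    by_cases hp : p ∈ S
    · have hq : q ∉ S := fun hq => hcon ⟨fun _ => hq, fun _ => hp⟩
      exact no_single_cut K hdeg S p q hpq hp hq h'
    · have hq : q ∈ S := by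
        by_contra hq
        exact hcon ⟨fun h => absurd h hp, fun h => absurd h hq⟩
      refine no_single_cut K hdeg S q p hpq.symm hq hp ?_
      rw [Sym2.eq_swap]; exact h'
  have hnot : ¬ ((a ∈ S ↔ b ∈ S) ∧ (c ∈ S ↔ d ∈ S)) := by
    rintro ⟨h1, h2⟩
    have h3 : ∀ x y, K.Adj x y → (x ∈ S ↔ y ∈ S) := by
      intro x y hA
      by_cases h4 : s(x, y) = s(a, b)
      · rw [Sym2.eq_iff] at h4
        rcases h4 with ⟨rfl, rfl⟩ | ⟨rfl, rfl⟩
        · exact h1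
        · exact h1.symm
      by_cases h5 : s(x, y) = s(c, d)
      · rw [Sym2.eq_iff] at h5
        rcases h5 with ⟨rfl, rfl⟩ | ⟨rfl, rfl⟩
        · exact h2
        · exact h2.symm
      exact hS x y hA h4 h5
    obtain ⟨p⟩ := hK.preconnected x0 y0
    have h6 : ∀ {x y : W} (p : K.Walk x y), x ∈ S → y ∈ S := by
      intro x y p
      induction p with
      | nil => exact id
      | cons h p ih => exact fun hx => ih ((h3 _ _ h).1 hx)
    exact hy0 (h6 p hx0)
  have k1 := key a b c d hab hS
  have k2 := key c d a b hcd (fun x y h1 h2 h3 => hS x y h1 h3 h2)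
  refine ⟨S, hS, ?_, ?_⟩ <;> tauto

/-- A proper 3-edge-colouring given by a symmetric function on ordered pairs. -/
theorem colourable3_of_fun {W : Type*} (G : SimpleGraph W) (g : W → W → Fin 3)
    (hs : ∀ x y, g x y = g y x)
    (h : ∀ x y z, G.Adj x y → G.Adj x z → y ≠ z → g x y ≠ g x z) : Colourable3 G := by
  refine ⟨Sym2.lift ⟨g, hs⟩, ?_⟩
  rintro e₁ h1 e₂ h2 hne ⟨v, hv1, hv2⟩
  obtain ⟨y, rfl⟩ := hv1
  obtain ⟨z, rfl⟩ := hv2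
  simp only [Sym2.lift_mk]
  exact h v y z h1 h2 (by rintro rfl; exact hne rfl)

theorem ei_ll (G : SimpleGraph V) (a b c d x y : V) :
    (edgeInsertion G a b c d).Adj (Sum.inl x) (Sum.inl y) ↔
      G.Adj x y ∧ s(x, y) ≠ s(a, b) ∧ s(x, y) ≠ s(c, d) := by
  simp only [edgeInsertion, SimpleGraph.fromEdgeSet_adj]
  constructor
  · rintro ⟨h, hne⟩
    rcases h with ⟨e, he, h⟩ | h
    · have h' : Sym2.map (Sum.inl : V → V ⊕ Fin 2) e = Sym2.map Sum.inl s(x, y) := h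
      have := Sym2.map.injective Sum.inl_injective h'
      subst this
      simpa using he
    · simp at h
  · rintro ⟨h1, h2, h3⟩
    refine ⟨Or.inl ⟨s(x, y), ⟨h1, ?_⟩, rfl⟩, by simpa using h1.ne⟩
    rintro (h | h)
    · exact h2 h
    · exact h3 h

theorem not_mem_img (E : Set (Sym2 V)) (n : Fin 2) (z : V ⊕ Fin 2) :
    s(z, Sum.inr n) ∉ Sym2.map Sum.inl '' E := by
  rintro ⟨e, _, h⟩
  induction e with
  | h p q => simp at h

theorem ei_l0 (G : SimpleGraph V) (a b c d x : V) :
    (edgeInsertion G a b c d).Adj (Sum.inl x) (Sum.inr 0) ↔ x = a ∨ x = b := by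
  simp only [edgeInsertion, SimpleGraph.fromEdgeSet_adj, Set.mem_union, not_mem_img]
  simp

theorem ei_l1 (G : SimpleGraph V) (a b c d x : V) :
    (edgeInsertion G a b c d).Adj (Sum.inl x) (Sum.inr 1) ↔ x = c ∨ x = d := by
  simp only [edgeInsertion, SimpleGraph.fromEdgeSet_adj, Set.mem_union, not_mem_img]
  simp

theorem ei_0l (G : SimpleGraph V) (a b c d x : V) :
    (edgeInsertion G a b c d).Adj (Sum.inr 0) (Sum.inl x) ↔ x = a ∨ x = b := by
  rw [SimpleGraph.adj_comm, ei_l0]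

theorem ei_1l (G : SimpleGraph V) (a b c d x : V) :
    (edgeInsertion G a b c d).Adj (Sum.inr 1) (Sum.inl x) ↔ x = c ∨ x = d := by
  rw [SimpleGraph.adj_comm, ei_l1]

/-- The recolouring, from a vertex set `S` splitting the bicoloured cycle. -/
theorem recolour (G : SimpleGraph V) (col : Sym2 V → Fin 3)
    (hcol : ∀ e₁ ∈ G.edgeSet, ∀ e₂ ∈ G.edgeSet,
      e₁ ≠ e₂ → (∃ v, v ∈ e₁ ∧ v ∈ e₂) → col e₁ ≠ col e₂)
    (i j : Fin 3) (hij : i ≠ j) (a b c d : V) (hab : G.Adj a b) (hcd : G.Adj c d)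
    (hac : a ≠ c) (had : a ≠ d) (hbc : b ≠ c) (hbd : b ≠ d)
    (cab : col s(a, b) = i ∨ col s(a, b) = j) (ccd : col s(c, d) = i ∨ col s(c, d) = j)
    (S : Set V)
    (hS : ∀ x y, G.Adj x y → (col s(x, y) = i ∨ col s(x, y) = j) → s(x, y) ≠ s(a, b) →
      s(x, y) ≠ s(c, d) → (x ∈ S ↔ y ∈ S))
    (hSab : a ∈ S ↔ b ∉ S) (hScd : c ∈ S ↔ d ∉ S) :
    Colourable3 (edgeInsertion G a b c d) := by
  obtain ⟨k, hki, hkj⟩ : ∃ k : Fin 3, k ≠ i ∧ k ≠ j := by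
    clear hS cab ccd; revert i j; decide
  have hk : ∀ l : Fin 3, l = i ∨ l = j ∨ l = k := by
    clear hS cab ccd; revert i j k; decide
  let σ : Equiv.Perm (Fin 3) := Equiv.swap i j
  have hσi : σ i = j := Equiv.swap_apply_left i j
  have hσj : σ j = i := Equiv.swap_apply_right i j
  have hσk : σ k = k := Equiv.swap_apply_of_ne_of_ne hki hkj
  let τ : V → Equiv.Perm (Fin 3) := fun x => if x ∈ S then σ else 1
  let E : Fin 2 → Sym2 V := fun n => if n = 0 then s(a, b) else s(c, d)
  let g : V ⊕ Fin 2 → V ⊕ Fin 2 → Fin 3 := fun p q =>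
    match p, q with
    | Sum.inl x, Sum.inl y => if x ∈ S ∨ y ∈ S then σ (col s(x, y)) else col s(x, y)
    | Sum.inl x, Sum.inr n => τ x (col (E n))
    | Sum.inr n, Sum.inl x => τ x (col (E n))
    | Sum.inr _, Sum.inr _ => k
  -- the original edge corresponding to an edge at an old vertex
  let π : V → V ⊕ Fin 2 → Sym2 V := fun x q =>
    match q with
    | Sum.inl y => s(x, y)
    | Sum.inr n => E n
  have hg : ∀ x q, (edgeInsertion G a b c d).Adj (Sum.inl x) q →
      g (Sum.inl x) q = τ x (col (π x q)) ∧ π x q ∈ G.edgeSet ∧ x ∈ π x q := by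
    intro x q hq
    rcases q with y | n
    · rw [ei_ll] at hq
      refine ⟨?_, hq.1, by simp [π]⟩
      simp only [g, τ, π]
      rcases hk (col s(x, y)) with h | h | h
      · have := hS x y hq.1 (Or.inl h) hq.2.1 hq.2.2
        by_cases hx : x ∈ S <;> simp_all
      · have := hS x y hq.1 (Or.inr h) hq.2.1 hq.2.2
        by_cases hx : x ∈ S <;> simp_all
      · rw [h]
        split_ifs <;> simp [hσk]
    · refine ⟨rfl, ?_⟩
      fin_cases n
      · have := (ei_l0 G a b c d x).1 hq
        simpa [π, E, hab] using this
      · have := (ei_l1 G a b c d x).1 hq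
        simpa [π, E, hcd] using this
  have hπ : ∀ x q r, (edgeInsertion G a b c d).Adj (Sum.inl x) q →
      (edgeInsertion G a b c d).Adj (Sum.inl x) r → π x q = π x r → q = r := by
    have hE : E 0 ≠ E 1 := by simp [E, hac, had]
    have hlr : ∀ x y n, (edgeInsertion G a b c d).Adj (Sum.inl x) (Sum.inl y) →
        s(x, y) ≠ E n := by
      intro x y n h
      rw [ei_ll] at h
      fin_cases n
      · exact h.2.1
      · exact h.2.2
    intro x q r hq hr h
    rcases q with y | n <;> rcases r with z | m <;> simp only [π] at h
    · rw [Sym2.congr_right] at h; rw [h]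
    · exact absurd h (hlr _ _ _ hq)
    · exact absurd h.symm (hlr _ _ _ hr)
    · have : n = m := by
        fin_cases n <;> fin_cases m
        · rfl
        · exact absurd h hE
        · exact absurd h.symm hE
        · rfl
      rw [this]
  have hτk : ∀ x n, τ x (col (E n)) ≠ k := by
    intro x n h
    have hτ : τ x k = k := by simp only [τ]; split_ifs <;> simp [hσk]
    have h' : col (E n) = k := (τ x).injective (h.trans hτ.symm)
    fin_cases n
    · have h2 : col s(a, b) = k := h'
      rcases cab with h1 | h1
      · exact hki (h2.symm.trans h1)
      · exact hkj (h2.symm.trans h1)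
    · have h2 : col s(c, d) = k := h'
      rcases ccd with h1 | h1
      · exact hki (h2.symm.trans h1)
      · exact hkj (h2.symm.trans h1)
  have hσ : ∀ l, (l = i ∨ l = j) → σ l ≠ l := by
    rintro l (rfl | rfl)
    · rw [hσi]; exact hij.symm
    · rw [hσj]; exact hij
  have hnew : ∀ n x y, (edgeInsertion G a b c d).Adj (Sum.inr n) (Sum.inl x) →
      (edgeInsertion G a b c d).Adj (Sum.inr n) (Sum.inl y) → x ≠ y →
      τ x (col (E n)) ≠ τ y (col (E n)) := by
    have aux : ∀ x y l, (l = i ∨ l = j) → (x ∈ S ↔ y ∉ S) → τ x l ≠ τ y l := by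
      intro x y l hl hxy
      simp only [τ]
      by_cases hx : x ∈ S
      · have hy := hxy.1 hx
        simpa [hx, hy] using hσ l hl
      · have hy : y ∈ S := by tauto
        simpa [hx, hy] using (hσ l hl).symm
    intro n x y hx hy hne
    fin_cases n
    · have hx := (ei_0l G a b c d x).1 hx
      have hy := (ei_0l G a b c d y).1 hy
      refine aux x y _ cab ?_
      rcases hx with rfl | rfl <;> rcases hy with rfl | rfl <;> tauto
    · have hx := (ei_1l G a b c d x).1 hx
      have hy := (ei_1l G a b c d y).1 hy
      refine aux x y _ ccd ?_
      rcases hx with rfl | rfl <;> rcases hy with rfl | rfl <;> tauto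
  refine colourable3_of_fun _ g ?_ ?_
  · rintro (x | n) (y | m)
    · simp only [g, Sym2.eq_swap (a := x) (b := y), or_comm]
    · rfl
    · rfl
    · rfl
  · rintro (x | n) q r hq hr hne
    · obtain ⟨h1, h2, h3⟩ := hg x q hq
      obtain ⟨h4, h5, h6⟩ := hg x r hr
      rw [h1, h4]
      intro h
      exact hcol _ h2 _ h5 (fun h => hne (hπ x q r hq hr h)) ⟨x, h3, h6⟩ ((τ x).injective h)
    · rcases q with x | p <;> rcases r with y | m
      · exact hnew n x y hq hr (by rintro rfl; exact hne rfl)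
      · exact hτk x n
      · exact (hτk y n).symm
      · have h1 := hq.ne
        have h2 := hr.ne
        exfalso
        have h1 : n ≠ p := fun h => h1 (congrArg Sum.inr h)
        have h2 : n ≠ m := fun h => h2 (congrArg Sum.inr h)
        have h3 : p ≠ m := fun h => hne (congrArg Sum.inr h)
        omega

/-- for a proper 3-edge-colouring of a cubic graph and two distinct colours i, j,
the edges coloured i or j form a 2-factor, and inserting an edge between two disjoint edges on
the same cycle of this 2-factor yields a colourable graph. -/
theorem edgeInsertion_colourable_of_colouring {V : Type*} [Fintype V]
    (G : SimpleGraph V) (hG : IsCubic G)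
    (col : Sym2 V → Fin 3)
    (hcol : ∀ e₁ ∈ G.edgeSet, ∀ e₂ ∈ G.edgeSet,
      e₁ ≠ e₂ → (∃ v, v ∈ e₁ ∧ v ∈ e₂) → col e₁ ≠ col e₂)
    (i j : Fin 3) (hij : i ≠ j) :
    (∃ F : G.Subgraph, IsTwoFactor F ∧
        F.edgeSet = {e ∈ G.edgeSet | col e = i ∨ col e = j}) ∧
    (∀ F : G.Subgraph, F.edgeSet = {e ∈ G.edgeSet | col e = i ∨ col e = j} →
      ∀ a b c d : V, G.Adj a b → G.Adj c d →
        a ≠ c → a ≠ d → b ≠ c → b ≠ d →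
        ∀ C : G.Subgraph, C ≤ F → IsCycleSub C →
          s(a, b) ∈ C.edgeSet → s(c, d) ∈ C.edgeSet →
          Colourable3 (edgeInsertion G a b c d)) := by
  have hinj : ∀ v x y, G.Adj v x → G.Adj v y → col s(v, x) = col s(v, y) → x = y := by
    intro v x y hx hy h
    by_contra hne
    exact hcol s(v, x) hx s(v, y) hy (by rw [Ne, Sym2.congr_right]; exact hne) ⟨v, by simp, by simp⟩ h
  have hsurj : ∀ v (l : Fin 3), ∃ w, G.Adj v w ∧ col s(v, w) = l := by
    intro v l
    have h1 : ((fun w => col s(v, w)) '' G.neighborSet v).ncard = 3 := by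
      have h0 : Set.InjOn (fun w => col s(v, w)) (G.neighborSet v) :=
        fun x hx y hy h => hinj v x y hx hy h
      rw [h0.ncard_image, hG v]
    have h2 : ((fun w => col s(v, w)) '' G.neighborSet v) = Set.univ := by
      apply Set.eq_of_subset_of_ncard_le (Set.subset_univ _)
      rw [h1, Set.ncard_univ]; simp
    have h3 : l ∈ ((fun w => col s(v, w)) '' G.neighborSet v) := h2 ▸ Set.mem_univ l
    exact h3
  constructor
  · refine ⟨{ verts := Set.univ
              Adj := fun x y => G.Adj x y ∧ (col s(x, y) = i ∨ col s(x, y) = j)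
              adj_sub := fun h => h.1
              edge_vert := fun _ => Set.mem_univ _
              symm := ⟨fun x y h => ⟨h.1.symm, by rw [Sym2.eq_swap]; exact h.2⟩⟩ },
      ⟨fun v => Set.mem_univ v, ?_⟩, ?_⟩
    · intro v _
      obtain ⟨p, hp, hpi⟩ := hsurj v i
      obtain ⟨q, hq, hqj⟩ := hsurj v j
      have hpq : p ≠ q := by
        rintro rfl
        exact hij (hpi.symm.trans hqj)
      rw [← Set.ncard_pair hpq]
      congr 1
      ext w
      simp only [SimpleGraph.Subgraph.mem_neighborSet, Set.mem_insert_iff, Set.mem_singleton_iff]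
      constructor
      · rintro ⟨h1, h2 | h2⟩
        · exact Or.inl (hinj v w p h1 hp (h2.trans hpi.symm))
        · exact Or.inr (hinj v w q h1 hq (h2.trans hqj.symm))
      · rintro (rfl | rfl)
        · exact ⟨hp, Or.inl hpi⟩
        · exact ⟨hq, Or.inr hqj⟩
    · ext e
      induction e with
      | h x y => exact Iff.rfl
  · intro F hF a b c d hab hcd hac had hbc hbd C hCF hC hCab hCcd
    have hFc : ∀ x y, C.Adj x y → G.Adj x y ∧ (col s(x, y) = i ∨ col s(x, y) = j) := by
      intro x y h
      have h1 : s(x, y) ∈ F.edgeSet := hCF.2 h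
      rw [hF] at h1
      exact h1
    have hCab : C.Adj a b := hCab
    have hCcd : C.Adj c d := hCcd
    have hclosed : ∀ x y, x ∈ C.verts → G.Adj x y → (col s(x, y) = i ∨ col s(x, y) = j) →
        C.Adj x y := by
      intro x y hx hxy hc
      obtain ⟨p, q, hpq, hN⟩ := Set.ncard_eq_two.1 (hC.2 x hx)
      have hp : C.Adj x p := by
        have : p ∈ C.neighborSet x := by rw [hN]; simp
        exact this
      have hq : C.Adj x q := by
        have : q ∈ C.neighborSet x := by rw [hN]; simp
        exact this
      obtain ⟨hp1, hp2⟩ := hFc x p hp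
      obtain ⟨hq1, hq2⟩ := hFc x q hq
      have hne : col s(x, p) ≠ col s(x, q) := fun h => hpq (hinj x p q hp1 hq1 h)
      have : col s(x, y) = col s(x, p) ∨ col s(x, y) = col s(x, q) := by
        rcases hc with h | h <;> rcases hp2 with h' | h' <;> rcases hq2 with h'' | h'' <;>
          simp_all
      rcases this with h | h
      · rw [hinj x y p hxy hp1 h]; exact hp
      · rw [hinj x y q hxy hq1 h]; exact hq
    have hdeg : ∀ v : C.verts, (C.coe.neighborSet v).ncard = 2 := by
      intro v
      rw [← hC.2 v v.2, ← Set.ncard_image_of_injective _ Subtype.val_injective]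
      congr 1
      ext w
      simp only [Set.mem_image, SimpleGraph.mem_neighborSet, SimpleGraph.Subgraph.coe_adj,
        SimpleGraph.Subgraph.mem_neighborSet]
      constructor
      · rintro ⟨u, hu, rfl⟩; exact hu
      · intro h; exact ⟨⟨w, C.edge_vert h.symm⟩, h, rfl⟩
    have va := C.edge_vert hCab
    have vb := C.edge_vert hCab.symm
    have vc := C.edge_vert hCcd
    have vd := C.edge_vert hCcd.symm
    obtain ⟨S, hS, h1, h2⟩ := exists_cut C.coe hC.1.coe hdeg ⟨a, va⟩ ⟨b, vb⟩ ⟨c, vc⟩ ⟨d, vd⟩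
      hCab hCcd (by simp [hac, had])
    have hmem : ∀ x (hx : x ∈ C.verts), x ∈ Subtype.val '' S ↔ (⟨x, hx⟩ : C.verts) ∈ S := by
      intro x hx
      simp [hx]
    refine recolour G col hcol i j hij a b c d hab hcd hac had hbc hbd (hFc a b hCab).2
      (hFc c d hCcd).2 (Subtype.val '' S) ?_ ?_ ?_
    · intro x y hxy hc hn1 hn2
      have main : ∀ x y, x ∈ C.verts → G.Adj x y → (col s(x, y) = i ∨ col s(x, y) = j) →
          s(x, y) ≠ s(a, b) → s(x, y) ≠ s(c, d) →
          (x ∈ Subtype.val '' S ↔ y ∈ Subtype.val '' S) := by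
        intro x y hx hxy hc hn1 hn2
        have hA := hclosed x y hx hxy hc
        have hy := C.edge_vert hA.symm
        rw [hmem x hx, hmem y hy]
        refine hS ⟨x, hx⟩ ⟨y, hy⟩ hA ?_ ?_
        · simpa using hn1
        · simpa using hn2
      by_cases hx : x ∈ C.verts
      · exact main x y hx hxy hc hn1 hn2
      by_cases hy : y ∈ C.verts
      · rw [Sym2.eq_swap] at hc hn1 hn2
        exact (main y x hy hxy.symm hc hn1 hn2).symm
      · constructor
        · rintro ⟨z, _, rfl⟩; exact absurd z.2 hx
        · rintro ⟨z, _, rfl⟩; exact absurd z.2 hy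
    · rw [hmem a va, hmem b vb]; exact h1
    · rw [hmem c vc, hmem d vd]; exact h2

end SnarkPaper
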